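/- arXiv:1911.01870 — 2 statements merged into one kernel-verified Lean document; each statement's English description precedes it below -/
import Mathlib

section
/- With Δ_T = {(u,v) ∈ [0,T]² : u ≤ v}: (i) for every ω ∈ Ω the map Δ_T × H ∋ (s,t,x) ↦ X_{s,t}^x(ω) ∈ H is of class C^{0,0,1}; (ii) the map Δ_T × Ω ∋ (s,t,ω) ↦ ∂_x X_{s,t}^{Y_s(ω)}(ω) ∈ L(H) is (ℬ(Δ_T) ⊗ 𝔉)/ℬ(L(H))-measurable; (iii) the map Δ_T × Ω ∋ (s,t,ω) ↦ X_{s,t}^{Y_s(ω)}(ω) ∈ H is (ℬ(Δ_T) ⊗ 𝔉)/ℬ(H)-measurable; and (iv) for all (s,t) ∈ Δ_T it holds that E[ ‖∂_x X_{s,t}^{Y_s}‖_{L(H)}^p ] ≤ E[ exp( p ∫_s^t ( ε ‖X_{s,u}^{Y_s}‖_{H_{1/2}}² + C ) du ) ]. -/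
open MeasureTheory Set
open scoped ENNReal RealInnerProductSpace NNReal

section ODE

open Filter Topology

variable {V : Type*} [NormedAddCommGroup V] [NormedSpace ℝ V]

theorem HasDerivWithinAt.Ici_of_Icc {f : ℝ → V} {f' : V} {a b t : ℝ}
    (h : HasDerivWithinAt f f' (Icc a b) t) (ht : t ∈ Ico a b) :
    HasDerivWithinAt f f' (Ici t) t :=
  (h.mono (Icc_subset_Icc_left ht.1)).mono_of_mem_nhdsWithin (Icc_mem_nhdsGE ht.2)

/-- A nonlinear Grönwall estimate: the differential inequality is only needed inside the region
given by the conclusion. -/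
theorem norm_le_mul_exp_of_norm_deriv_le {f f' : ℝ → V} {L κ : ℝ} (hL : 0 ≤ L) (hκ : 0 < κ)
    (hf : ∀ t ∈ Icc (0 : ℝ) 1, HasDerivWithinAt f (f' t) (Icc 0 1) t) (h0 : ‖f 0‖ ≤ κ)
    (bound : ∀ t ∈ Icc (0 : ℝ) 1, ‖f t‖ ≤ κ * Real.exp (L + 2) → ‖f' t‖ ≤ L * ‖f t‖ + κ) :
    ∀ t ∈ Icc (0 : ℝ) 1, ‖f t‖ ≤ κ * Real.exp (L + 2) := by
  have hmono : ∀ t ∈ Icc (0 : ℝ) 1, κ * Real.exp ((L + 2) * t) ≤ κ * Real.exp (L + 2) := by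
    intro t ht
    gcongr
    nlinarith [ht.2]
  have hB (t : ℝ) : HasDerivAt (fun t => κ * Real.exp ((L + 2) * t))
      (κ * (Real.exp ((L + 2) * t) * ((L + 2) * 1))) t :=
    (((hasDerivAt_id t).const_mul (L + 2)).exp).const_mul κ
  have key := image_norm_le_of_norm_deriv_right_lt_deriv_boundary' (f := f) (f' := f') (a := 0)
    (b := 1) (B := fun t => κ * Real.exp ((L + 2) * t))
    (B' := fun t => κ * (Real.exp ((L + 2) * t) * ((L + 2) * 1)))
    (fun t ht => (hf t ht).continuousWithinAt)
    (fun t ht => (hf t (Ico_subset_Icc_self ht)).Ici_of_Icc ht) (by simpa using h0)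
    (fun t _ => (hB t).continuousAt.continuousWithinAt)
    (fun t _ => (hB t).hasDerivWithinAt) ?_
  · exact fun t ht => (key ht).trans (hmono t ht)
  · intro t ht hft
    have ht' := Ico_subset_Icc_self ht
    have h1 := bound t ht' (hft.le.trans (hmono t ht'))
    have h2 : 1 ≤ Real.exp ((L + 2) * t) := Real.one_le_exp (by have := ht.1; positivity)
    rw [hft] at h1
    nlinarith

/-- Continuous dependence on parameters of solutions on `[0, 1]` of a locally Lipschitz ordinary
differential equation. -/
theorem continuous_parametric_ODE_solution [ProperSpace V] {Λ : Type*} [TopologicalSpace Λ]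
    {W : Λ → ℝ → V → V} (hW : Continuous fun q : Λ × ℝ × V => W q.1 q.2.1 q.2.2)
    (hLip : ∀ l R, ∃ L, 0 ≤ L ∧ ∀ t ∈ Icc (0 : ℝ) 1, ∀ x ∈ Metric.closedBall (0 : V) R,
      ∀ y ∈ Metric.closedBall (0 : V) R, ‖W l t x - W l t y‖ ≤ L * ‖x - y‖)
    {y : Λ → ℝ → V} (hy0 : Continuous fun l => y l 0)
    (hy : ∀ l, ∀ t ∈ Icc (0 : ℝ) 1, HasDerivWithinAt (y l) (W l t (y l t)) (Icc 0 1) t) :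
    Continuous fun q : Λ × ℝ => y q.1 (projIcc (0 : ℝ) 1 zero_le_one q.2) := by
  have hyc (l : Λ) : ContinuousOn (y l) (Icc 0 1) := fun t ht => (hy l t ht).continuousWithinAt
  have key : ∀ l₀, ∀ ε > 0, ∀ᶠ l in 𝓝 l₀, ∀ t ∈ Icc (0 : ℝ) 1, ‖y l t - y l₀ t‖ ≤ ε := by
    intro l₀ ε hε
    obtain ⟨R, hR⟩ := isCompact_Icc.exists_bound_of_continuousOn (hyc l₀)
    obtain ⟨L, hL0, hL⟩ := hLip l₀ (R + 1)
    set κ := min ε 1 * Real.exp (-(L + 2)) with hκdef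
    have hκ : 0 < κ := by positivity
    have hκexp : κ * Real.exp (L + 2) = min ε 1 := by
      rw [hκdef, mul_assoc, ← Real.exp_add]; simp
    have hclose : ∀ᶠ l in 𝓝 l₀, ∀ k ∈ Icc (0 : ℝ) 1 ×ˢ Metric.closedBall (0 : V) (R + 1),
        ‖W l k.1 k.2 - W l₀ k.1 k.2‖ < κ := by
      refine (isCompact_Icc.prod (isCompact_closedBall _ _)).eventually_forall_of_forall_eventually
        fun k _ => ?_
      have : Continuous fun z : Λ × ℝ × V => ‖W z.1 z.2.1 z.2.2 - W l₀ z.2.1 z.2.2‖ :=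
        (hW.sub (hW.comp (continuous_const.prodMk continuous_snd))).norm
      exact this.continuousAt.eventually_lt continuousAt_const (by simpa using hκ)
    have hinit : ∀ᶠ l in 𝓝 l₀, ‖y l 0 - y l₀ 0‖ < κ :=
      ((hy0.sub continuous_const).norm.continuousAt).eventually_lt continuousAt_const
        (by simpa using hκ)
    filter_upwards [hclose, hinit] with l hl hl0 t ht
    refine (norm_le_mul_exp_of_norm_deriv_le hL0 hκ
      (f := fun t => y l t - y l₀ t) (fun t ht => (hy l t ht).sub (hy l₀ t ht)) hl0.le
      (fun t ht hb => ?_) t ht).trans (hκexp.le.trans (min_le_left _ _))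
    replace hb : ‖y l t - y l₀ t‖ ≤ 1 := hb.trans (hκexp.le.trans (min_le_right _ _))
    have h1 : y l t ∈ Metric.closedBall (0 : V) (R + 1) := by
      rw [mem_closedBall_zero_iff]
      have := norm_add_le (y l₀ t) (y l t - y l₀ t)
      rw [add_sub_cancel] at this
      linarith [hR t ht]
    have h2 : y l₀ t ∈ Metric.closedBall (0 : V) (R + 1) := by
      rw [mem_closedBall_zero_iff]
      linarith [hR t ht]
    calc ‖W l t (y l t) - W l₀ t (y l₀ t)‖
        ≤ ‖W l t (y l t) - W l₀ t (y l t)‖ + ‖W l₀ t (y l t) - W l₀ t (y l₀ t)‖ :=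
          norm_sub_le_norm_sub_add_norm_sub _ _ _
      _ ≤ L * ‖y l t - y l₀ t‖ + κ := by
          linarith [hl (t, y l t) ⟨ht, h1⟩, hL t ht _ h1 _ h2]
  rw [continuous_iff_continuousAt]
  rintro ⟨l₀, t₀⟩
  have hc : Continuous fun t : ℝ => y l₀ (projIcc (0 : ℝ) 1 zero_le_one t) :=
    (continuousOn_iff_continuous_domRestrict.1 (hyc l₀)).comp continuous_projIcc
  rw [Metric.continuousAt_iff']
  intro ε hε
  have h1 := (key l₀ (ε / 2) (half_pos hε)).prod_inl_nhds t₀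
  have h2 := (Metric.continuousAt_iff'.1 (hc.continuousAt (x := t₀)) _
    (half_pos hε)).prod_inr_nhds l₀
  filter_upwards [h1, h2] with q hq1 hq2
  have := hq1 _ (projIcc (0 : ℝ) 1 zero_le_one q.2).2
  rw [← dist_eq_norm] at this
  linarith [dist_triangle (y q.1 (projIcc (0 : ℝ) 1 zero_le_one q.2))
    (y l₀ (projIcc (0 : ℝ) 1 zero_le_one q.2)) (y l₀ (projIcc (0 : ℝ) 1 zero_le_one t₀))]

/-- Global existence on `[0, 1]` of solutions of linear ordinary differential equations. -/
theorem exists_linear_ODE_solution [CompleteSpace V] {B : ℝ → V →L[ℝ] V} (hB : Continuous B)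
    (u₀ : V) :
    ∃ u : ℝ → V, u 0 = u₀ ∧
      ∀ t ∈ Icc (0 : ℝ) 1, HasDerivWithinAt u (B t (u t)) (Icc 0 1) t := by
  obtain ⟨K, hK⟩ := isCompact_Icc.exists_bound_of_continuousOn
    (hB.continuousOn (s := Icc (0 : ℝ) 1))
  have hK0 : 0 ≤ K := (norm_nonneg _).trans (hK 0 (by simp))
  set m : ℝ := 2 * K + 1 with hm
  have hm0 : 0 < m := by positivity
  let g (w : C(Icc (0 : ℝ) 1, V)) (r : ℝ) : V :=
    Real.exp (m * r) • B r (w (projIcc 0 1 zero_le_one r))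
  have hg (w : C(Icc (0 : ℝ) 1, V)) : Continuous (g w) := by
    have : Continuous fun r => w (projIcc (0 : ℝ) 1 zero_le_one r) :=
      w.continuous.comp continuous_projIcc
    exact (by fun_prop : Continuous fun r => Real.exp (m * r)).smul (hB.clm_apply this)
  have hgi (w : C(Icc (0 : ℝ) 1, V)) (t : ℝ) :
      HasDerivAt (fun t => ∫ r in (0 : ℝ)..t, g w r) (g w t) t :=
    intervalIntegral.integral_hasDerivAt_right ((hg w).intervalIntegrable _ _)
      ((hg w).stronglyMeasurableAtFilter _ _) (hg w).continuousAt
  let Φ (w : C(Icc (0 : ℝ) 1, V)) : C(Icc (0 : ℝ) 1, V) :=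
    ⟨fun t => Real.exp (-(m * t)) • (u₀ + ∫ r in (0 : ℝ)..t, g w r), by
      have h1 : Continuous fun t : ℝ => ∫ r in (0 : ℝ)..t, g w r :=
        continuous_iff_continuousAt.2 fun t => (hgi w t).continuousAt
      have h2 := h1.comp (continuous_subtype_val (p := fun t => t ∈ Icc (0 : ℝ) 1))
      exact (by fun_prop : Continuous fun t : Icc (0 : ℝ) 1 => Real.exp (-(m * t))).smul
        (continuous_const.add h2)⟩
  have hΦ : ContractingWith (1 / 2) Φ := by
    refine ⟨by norm_num, LipschitzWith.of_dist_le_mul fun w z => ?_⟩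
    rw [ContinuousMap.dist_le (by positivity)]
    rintro ⟨t, ht⟩
    have hsub : Φ w ⟨t, ht⟩ - Φ z ⟨t, ht⟩
        = Real.exp (-(m * t)) • ∫ r in (0 : ℝ)..t, (g w r - g z r) := by
      rw [intervalIntegral.integral_sub ((hg w).intervalIntegrable _ _)
        ((hg z).intervalIntegrable _ _)]
      simp only [Φ, ContinuousMap.coe_mk, ← smul_sub, add_sub_add_left_eq_sub]
    have hint : ‖∫ r in (0 : ℝ)..t, (g w r - g z r)‖
        ≤ ∫ r in (0 : ℝ)..t, K * dist w z * Real.exp (m * r) := by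
      refine intervalIntegral.norm_integral_le_of_norm_le ht.1 (ae_of_all _ fun r hr => ?_)
        ((by fun_prop : Continuous fun r => K * dist w z * Real.exp (m * r)).intervalIntegrable _ _)
      have hr' : r ∈ Icc (0 : ℝ) 1 := ⟨hr.1.le, hr.2.trans ht.2⟩
      simp only [g]
      rw [← smul_sub, ← map_sub, norm_smul, Real.norm_eq_abs, Real.abs_exp, mul_comm]
      gcongr
      refine (ContinuousLinearMap.le_opNorm _ _).trans ?_
      gcongr
      · exact hK r hr'
      · rw [← dist_eq_norm]; exact ContinuousMap.dist_apply_le_dist _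
    have hval : ∫ r in (0 : ℝ)..t, K * dist w z * Real.exp (m * r)
        = K * dist w z * ((Real.exp (m * t) - 1) / m) := by
      rw [intervalIntegral.integral_const_mul, intervalIntegral.integral_comp_mul_left _ hm0.ne',
        integral_exp]
      simp [div_eq_inv_mul]
    rw [dist_eq_norm, hsub, norm_smul, Real.norm_eq_abs, Real.abs_exp]
    have he : Real.exp (-(m * t)) * Real.exp (m * t) = 1 := by rw [← Real.exp_add]; simp
    have hd : 0 ≤ dist w z := dist_nonneg
    calc Real.exp (-(m * t)) * ‖∫ r in (0 : ℝ)..t, (g w r - g z r)‖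
        ≤ Real.exp (-(m * t)) * (K * dist w z * (Real.exp (m * t) / m)) := by
          gcongr
          refine hint.trans (hval.le.trans ?_)
          gcongr
          linarith
      _ = K / m * dist w z := by
          linear_combination (K * dist w z / m) * he
      _ ≤ ((1 / 2 : ℝ≥0) : ℝ) * dist w z := by
          gcongr
          rw [div_le_iff₀ hm0]
          push_cast
          linarith
  set w := ContractingWith.fixedPoint Φ hΦ
  have hw : Φ w = w := hΦ.fixedPoint_isFixedPt
  have hwt (t : ℝ) (ht : t ∈ Icc (0 : ℝ) 1) :
      u₀ + ∫ r in (0 : ℝ)..t, g w r = Real.exp (m * t) • w ⟨t, ht⟩ := by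
    conv_rhs => rw [← hw]
    simp only [Φ, ContinuousMap.coe_mk, smul_smul, ← Real.exp_add]
    simp
  refine ⟨fun t => u₀ + ∫ r in (0 : ℝ)..t, g w r, by simp, fun t ht => ?_⟩
  have := ((hgi w t).const_add u₀).hasDerivWithinAt (s := Icc (0 : ℝ) 1)
  beta_reduce
  rw [hwt t ht]
  simpa [g, projIcc_of_mem _ ht] using this

end ODE

section Flow

open Topology

variable {H : Type*} [NormedAddCommGroup H] [NormedSpace ℝ H] [FiniteDimensional ℝ H]

/-- Continuously differentiable dependence on the initial value, jointly continuous in parameters,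
of solutions on `[0, 1]` of ordinary differential equations. -/
theorem contDiff_parametric_ODE_solution {Λ : Type*} [TopologicalSpace Λ]
    {G : Λ → ℝ → H → H} {G' : Λ → ℝ → H → H →L[ℝ] H}
    (hG : Continuous fun q : Λ × ℝ × H => G q.1 q.2.1 q.2.2)
    (hG' : Continuous fun q : Λ × ℝ × H => G' q.1 q.2.1 q.2.2)
    (hGG' : ∀ l t x, HasFDerivAt (G l t) (G' l t x) x)
    {c : Λ → H} (hc : Continuous c) {y : Λ → H → ℝ → H} (hy0 : ∀ l z, y l z 0 = z + c l)
    (hy : ∀ l z, ∀ t ∈ Icc (0 : ℝ) 1, HasDerivWithinAt (y l z) (G l t (y l z t)) (Icc 0 1) t) :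
    Continuous (fun q : Λ × H => y q.1 q.2 1) ∧
    ∃ D : Λ → H → ℝ → H →L[ℝ] H, (∀ l z, D l z 0 = ContinuousLinearMap.id ℝ H) ∧
      (∀ l z, ∀ t ∈ Icc (0 : ℝ) 1,
        HasDerivWithinAt (D l z) ((G' l t (y l z t)).comp (D l z t)) (Icc 0 1) t) ∧
      (∀ l z, HasFDerivAt (fun z => y l z 1) (D l z 1) z) ∧
      Continuous fun q : Λ × H => D q.1 q.2 1 := by
  have : ProperSpace H := FiniteDimensional.proper ℝ H
  have : ProperSpace (H →L[ℝ] H) := FiniteDimensional.proper ℝ _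
  have hycont : Continuous fun q : (Λ × H) × ℝ =>
      y q.1.1 q.1.2 (projIcc (0 : ℝ) 1 zero_le_one q.2) := by
    refine continuous_parametric_ODE_solution (Λ := Λ × H) (W := fun l => G l.1)
      (y := fun l => y l.1 l.2) (hG.comp (by fun_prop : Continuous fun q : (Λ × H) × ℝ × H =>
        (q.1.1, q.2.1, q.2.2))) (fun l R => ?_) ?_ (fun l => hy l.1 l.2)
    · have hcpt := isCompact_Icc (a := (0 : ℝ)) (b := 1) |>.prod (isCompact_closedBall (0 : H) R)
      obtain ⟨L, hL⟩ := hcpt.exists_bound_of_continuousOn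
        (hG'.comp (by fun_prop : Continuous fun q : ℝ × H => (l.1, q.1, q.2))).continuousOn
      refine ⟨max L 0, le_max_right _ _, fun t ht x hx z hz => ?_⟩
      exact (convex_closedBall (0 : H) R).norm_image_sub_le_of_norm_hasFDerivWithin_le
        (fun x _ => (hGG' l.1 t x).hasFDerivWithinAt)
        (fun x hx => (hL (t, x) ⟨ht, hx⟩).trans (le_max_left _ _)) hz hx
    · simp only [hy0]
      fun_prop
  set B : Λ × H → ℝ → H →L[ℝ] H := fun l t =>
    G' l.1 t (y l.1 l.2 (projIcc (0 : ℝ) 1 zero_le_one t)) with hBdef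
  have hB : Continuous fun q : (Λ × H) × ℝ => B q.1 q.2 :=
    hG'.comp ((by fun_prop : Continuous fun q : (Λ × H) × ℝ => q.1.1).prodMk
      (continuous_snd.prodMk hycont))
  have hBl (l : Λ × H) : Continuous (B l) := hB.comp (continuous_const.prodMk continuous_id)
  have hBt (l : Λ) (z : H) {t : ℝ} (ht : t ∈ Icc (0 : ℝ) 1) : B (l, z) t = G' l t (y l z t) := by
    simp [hBdef, projIcc_of_mem _ ht]
  have hex (l : Λ × H) := exists_linear_ODE_solution
    (B := fun t => ContinuousLinearMap.compL ℝ H H H (B l t))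
    ((ContinuousLinearMap.compL ℝ H H H).continuous.comp (hBl l)) (ContinuousLinearMap.id ℝ H)
  choose D hD0 hD using hex
  simp only [ContinuousLinearMap.compL_apply] at hD
  have hDcont : Continuous fun q : (Λ × H) × ℝ => D q.1 (projIcc (0 : ℝ) 1 zero_le_one q.2) := by
    refine continuous_parametric_ODE_solution (W := fun l t M => (B l t).comp M)
      (y := D) ?_ (fun l R => ?_) ?_ hD
    · exact (hB.comp (by fun_prop : Continuous fun q : (Λ × H) × ℝ × (H →L[ℝ] H) =>
        (q.1, q.2.1))).clm_comp (by fun_prop)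
    · obtain ⟨L, hL⟩ := isCompact_Icc.exists_bound_of_continuousOn
        ((hBl l).continuousOn (s := Icc (0 : ℝ) 1))
      refine ⟨max L 0, le_max_right _ _, fun t ht M _ N _ => ?_⟩
      rw [← ContinuousLinearMap.comp_sub]
      refine (ContinuousLinearMap.opNorm_comp_le _ _).trans ?_
      gcongr
      exact (hL t ht).trans (le_max_left _ _)
    · simp only [hD0]
      exact continuous_const
  have hone : ((projIcc (0 : ℝ) 1 zero_le_one 1 : Icc (0 : ℝ) 1) : ℝ) = 1 := by
    rw [projIcc_right]
  refine ⟨?_, fun l z => D (l, z), fun l z => hD0 _, fun l z t ht => ?_, fun l z => ?_, ?_⟩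
  · simpa only [Function.comp_def, hone, id] using hycont.comp
      (continuous_id.prodMk (continuous_const (y := (1 : ℝ))))
  · rw [← hBt l z ht]
    exact hD _ t ht
  swap
  · simpa only [Function.comp_def, hone, id] using hDcont.comp
      (continuous_id.prodMk (continuous_const (y := (1 : ℝ))))
  obtain ⟨K, hK⟩ := isCompact_Icc.exists_bound_of_continuousOn
    ((hBl (l, z)).continuousOn (s := Icc (0 : ℝ) 1))
  obtain ⟨M, hM⟩ := isCompact_Icc.exists_bound_of_continuousOn
    (fun t ht => (hD (l, z) t ht).continuousWithinAt : ContinuousOn (D (l, z)) (Icc 0 1))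
  have hK0 : 0 ≤ K := (norm_nonneg _).trans (hK 0 (by simp))
  have hM0 : 0 ≤ M := (norm_nonneg _).trans (hM 0 (by simp))
  rw [hasFDerivAt_iff_isLittleO_nhds_zero, Asymptotics.isLittleO_iff]
  intro ε hε
  set S := (M + 1) * Real.exp (K + 1 + 2)
  have hS : 0 < S := by positivity
  set η := min 1 (ε / S)
  have hη : 0 < η := by positivity
  have hη1 : η ≤ 1 := min_le_left _ _
  have hηε : η * S ≤ ε := (le_div_iff₀ hS).1 (min_le_right _ _)
  have hG'close : ∀ᶠ e in 𝓝 (0 : H), ∀ t ∈ Icc (0 : ℝ) 1,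
      ‖G' l t (y l z (projIcc (0 : ℝ) 1 zero_le_one t) + e) - B (l, z) t‖ < η := by
    refine isCompact_Icc.eventually_forall_of_forall_eventually fun t _ => ?_
    have hyt : Continuous fun q : H × ℝ => y l z (projIcc (0 : ℝ) 1 zero_le_one q.2) :=
      hycont.comp (by fun_prop : Continuous fun q : H × ℝ => ((l, z), q.2))
    have : Continuous fun q : H × ℝ =>
        ‖G' l q.2 (y l z (projIcc (0 : ℝ) 1 zero_le_one q.2) + q.1) - B (l, z) q.2‖ :=
      ((hG'.comp (continuous_const.prodMk (continuous_snd.prodMk (hyt.add continuous_fst)))).sub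
        ((hBl (l, z)).comp continuous_snd)).norm
    exact this.continuousAt.eventually_lt continuousAt_const (by simpa [hBdef] using hη)
  obtain ⟨δ, hδ, hδG⟩ := Metric.eventually_nhds_iff.1 hG'close
  have hyclose : ∀ᶠ h in 𝓝 (0 : H), ∀ t ∈ Icc (0 : ℝ) 1,
      ‖y l (z + h) (projIcc (0 : ℝ) 1 zero_le_one t)
        - y l z (projIcc (0 : ℝ) 1 zero_le_one t)‖ < δ := by
    refine isCompact_Icc.eventually_forall_of_forall_eventually fun t _ => ?_
    have : Continuous fun q : H × ℝ => ‖y l (z + q.1) (projIcc (0 : ℝ) 1 zero_le_one q.2)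
        - y l z (projIcc (0 : ℝ) 1 zero_le_one q.2)‖ :=
      ((hycont.comp (by fun_prop : Continuous fun q : H × ℝ => ((l, z + q.1), q.2))).sub
        (hycont.comp (by fun_prop : Continuous fun q : H × ℝ => ((l, z), q.2)))).norm
    exact this.continuousAt.eventually_lt continuousAt_const (by simpa using hδ)
  filter_upwards [hyclose] with h hh
  rcases eq_or_ne h 0 with rfl | hne
  · simp
  have hpos : 0 < ‖h‖ := norm_pos_iff.2 hne
  have hfence := norm_le_mul_exp_of_norm_deriv_le (L := K + 1) (κ := η * (M + 1) * ‖h‖)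
    (f := fun t => y l (z + h) t - y l z t - D (l, z) t h)
    (f' := fun t => G l t (y l (z + h) t) - G l t (y l z t) - (B (l, z) t) (D (l, z) t h))
    (by positivity) (by positivity)
    (fun t ht => ((hy l (z + h) t ht).sub (hy l z t ht)).sub
      (by simpa using (hD (l, z) t ht).clm_apply (hasDerivWithinAt_const t (Icc 0 1) h)))
    (by simp only [hy0, hD0]; simp; positivity) (fun t ht _ => ?_) 1 (by simp)
  · refine hfence.trans (le_trans (le_of_eq ?_) (mul_le_mul_of_nonneg_right hηε hpos.le))
    simp only [S]; ring
  have hproj : ((projIcc (0 : ℝ) 1 zero_le_one t : Icc (0 : ℝ) 1) : ℝ) = t := by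
    rw [projIcc_of_mem _ ht]
  set e := y l (z + h) t - y l z t - D (l, z) t h with he
  have hdiff : ‖y l (z + h) t - y l z t‖ ≤ ‖e‖ + M * ‖h‖ := by
    have h1 : y l (z + h) t - y l z t = e + D (l, z) t h := by simp [he]
    rw [h1]
    refine (norm_add_le _ _).trans ?_
    gcongr
    exact ((D (l, z) t).le_opNorm h).trans (by gcongr; exact hM t ht)
  have hrem : ‖G l t (y l (z + h) t) - G l t (y l z t)
      - B (l, z) t (y l (z + h) t - y l z t)‖ ≤ η * ‖y l (z + h) t - y l z t‖ := by
    refine (convex_ball (y l z t) δ).norm_image_sub_le_of_norm_hasFDerivWithin_le'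
      (fun x _ => (hGG' l t x).hasFDerivWithinAt) (fun x hx => ?_) (Metric.mem_ball_self hδ) ?_
    · have := hδG (y := x - y l z t) (by simpa [dist_eq_norm] using hx) t ht
      rw [hproj, add_sub_cancel] at this
      exact this.le
    · rw [mem_ball_iff_norm]
      simpa only [hproj] using hh t ht
  have hsplit : G l t (y l (z + h) t) - G l t (y l z t) - (B (l, z) t) (D (l, z) t h)
      = (G l t (y l (z + h) t) - G l t (y l z t) - B (l, z) t (y l (z + h) t - y l z t))
        + B (l, z) t e := by
    simp only [he, map_sub]; abel
  have hBe : ‖B (l, z) t e‖ ≤ K * ‖e‖ :=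
    ((B (l, z) t).le_opNorm e).trans (by gcongr; exact hK t ht)
  calc _ ≤ η * ‖y l (z + h) t - y l z t‖ + K * ‖e‖ := by
        rw [hsplit]; exact (norm_add_le _ _).trans (add_le_add hrem hBe)
    _ ≤ η * (‖e‖ + M * ‖h‖) + K * ‖e‖ := by gcongr
    _ ≤ (K + 1) * ‖e‖ + η * (M + 1) * ‖h‖ := by
        nlinarith [mul_le_mul_of_nonneg_right hη1 (norm_nonneg e), mul_pos hη hpos]

end Flow

theorem le_mul_exp_integral_of_deriv_le {f f' c : ℝ → ℝ} (hc : Continuous c)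
    (hf : ∀ t ∈ Icc (0 : ℝ) 1, HasDerivWithinAt f (f' t) (Icc 0 1) t)
    (hle : ∀ t ∈ Icc (0 : ℝ) 1, f' t ≤ c t * f t) :
    f 1 ≤ f 0 * Real.exp (∫ t in (0 : ℝ)..1, c t) := by
  have hint (t : ℝ) : HasDerivAt (fun t => ∫ r in (0 : ℝ)..t, c r) (c t) t :=
    intervalIntegral.integral_hasDerivAt_right (hc.intervalIntegrable _ _)
      (hc.stronglyMeasurableAtFilter _ _) hc.continuousAt
  have hN (t : ℝ) (ht : t ∈ Icc (0 : ℝ) 1) := (hf t ht).mul (hint t).neg.exp.hasDerivWithinAt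
  have key := image_le_of_deriv_right_le_deriv_boundary (a := 0) (b := 1)
    (fun t ht => (hN t ht).continuousWithinAt)
    (fun t ht => (hN t (Ico_subset_Icc_self ht)).Ici_of_Icc ht) (B := fun _ => f 0) (B' := 0)
    (by simp) continuousOn_const (fun t _ => hasDerivWithinAt_const _ _ _) (fun t ht => ?_)
    (right_mem_Icc.2 zero_le_one)
  · simp only [Pi.mul_apply, Pi.neg_apply] at key
    calc f 1 = f 1 * Real.exp (-∫ t in (0 : ℝ)..1, c t) * Real.exp (∫ t in (0 : ℝ)..1, c t) := by
          rw [mul_assoc, ← Real.exp_add]; simp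
      _ ≤ _ := by gcongr
  · have h1 := mul_le_mul_of_nonneg_right (hle t (Ico_subset_Icc_self ht))
      (Real.exp_pos (-∫ r in (0 : ℝ)..t, c r)).le
    simp only [Pi.neg_apply, Pi.zero_apply]
    linarith

section Mild

open Filter

variable {H : Type*} [NormedAddCommGroup H] [InnerProductSpace ℝ H] {ι : Type*} [Fintype ι]

theorem hasDerivWithinAt_of_mild_equation [CompleteSpace H] (b : OrthonormalBasis ι ℝ H)
    {lam : ι → ℝ} {A : H → H} (hA : ∀ v, A v = ∑ i, (lam i * ⟪b i, v⟫) • b i)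
    {E : ℝ → H → H} (hE : ∀ t v, E t v = ∑ i, (Real.exp (t * lam i) * ⟪b i, v⟫) • b i)
    {s T : ℝ} (hsT : s ≤ T) {k : ℝ → H} (hk : ContinuousOn k (Icc s T)) (z : H) {Z : ℝ → H}
    (hZ : ∀ t ∈ Icc s T, Z t = E (t - s) z + ∫ u in s..t, E (t - u) (k u)) {t : ℝ}
    (ht : t ∈ Icc s T) : HasDerivWithinAt Z (A (Z t) + k t) (Icc s T) t := by
  set K : ℝ → H := fun u => k (projIcc s T hsT u)
  have hK : Continuous K := (continuousOn_iff_continuous_domRestrict.1 hk).comp continuous_projIcc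
  have hKk : ∀ u ∈ Icc s T, K u = k u := fun u hu => by simp [K, projIcc_of_mem _ hu]
  have hEi (i : ι) (t : ℝ) (v : H) : ⟪b i, E t v⟫ = Real.exp (t * lam i) * ⟪b i, v⟫ := by
    classical
    simp [hE, inner_sum, inner_smul_right, b.inner_eq_ite]
  have hEc (t : ℝ) : Continuous fun u => E (t - u) (K u) := by
    simp only [hE]
    fun_prop
  set J : ι → ℝ → ℝ := fun i t => Real.exp (t * lam i) *
    (Real.exp (-(s * lam i)) * ⟪b i, z⟫ + ∫ u in s..t, Real.exp (-(u * lam i)) * ⟪b i, K u⟫)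
    with hJdef
  have hJ : ∀ i, ∀ t ∈ Icc s T, ⟪b i, Z t⟫ = J i t := by
    intro i t ht
    have h1 : ∫ u in s..t, E (t - u) (k u) = ∫ u in s..t, E (t - u) (K u) := by
      refine intervalIntegral.integral_congr fun u hu => ?_
      rw [uIcc_of_le ht.1] at hu
      simp only [hKk u ⟨hu.1, hu.2.trans ht.2⟩]
    have h2 : ⟪b i, ∫ u in s..t, E (t - u) (K u)⟫ = ∫ u in s..t, ⟪b i, E (t - u) (K u)⟫ :=
      ((innerSL ℝ (b i)).intervalIntegral_comp_comm ((hEc t).intervalIntegrable _ _)).symm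
    rw [hZ t ht, h1, inner_add_right, h2, hEi, hJdef]
    simp only [hEi]
    rw [mul_add, ← mul_assoc, ← Real.exp_add, ← intervalIntegral.integral_const_mul]
    congr 1
    · congr 2; ring
    · congr 1
      ext u
      rw [← mul_assoc, ← Real.exp_add]
      congr 2; ring
  have hJ' (i : ι) (t : ℝ) : HasDerivAt (J i) (lam i * J i t + ⟪b i, K t⟫) t := by
    have hc : Continuous fun u => Real.exp (-(u * lam i)) * ⟪b i, K u⟫ := by fun_prop
    have h1 := (intervalIntegral.integral_hasDerivAt_right (hc.intervalIntegrable s t)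
      (hc.stronglyMeasurableAtFilter _ _) hc.continuousAt).const_add
        (Real.exp (-(s * lam i)) * ⟪b i, z⟫)
    have h2 := ((hasDerivAt_id t).mul_const (lam i)).exp.mul h1
    refine h2.congr_deriv ?_
    have h3 : Real.exp (t * lam i) * Real.exp (-(t * lam i)) = 1 := by rw [← Real.exp_add]; simp
    simp only [hJdef, id]
    linear_combination ⟪b i, K t⟫ * h3
  have hsum : HasDerivWithinAt (fun t => ∑ i, J i t • b i)
      (∑ i, (lam i * J i t + ⟪b i, K t⟫) • b i) (Icc s T) t :=
    HasDerivWithinAt.fun_sum fun i _ => ((hJ' i t).smul_const (b i)).hasDerivWithinAt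
  have hZsum : ∀ t ∈ Icc s T, Z t = ∑ i, J i t • b i := fun t ht => by
    rw [← b.sum_repr' (Z t)]
    simp only [hJ _ t ht]
  refine (hsum.congr hZsum (hZsum t ht)).congr_deriv ?_
  simp only [add_smul, Finset.sum_add_distrib, hA, hJ _ t ht, b.sum_repr', hKk t ht]

variable [FiniteDimensional ℝ H]

/-- Regularity in all arguments, and a bound for the spatial derivative, of the solution flow of a
mild equation with additive continuous forcing `o`. -/
theorem mild_flow_regularity (b : OrthonormalBasis ι ℝ H)
    {lam : ι → ℝ} {A : H → H} (hA : ∀ v, A v = ∑ i, (lam i * ⟪b i, v⟫) • b i)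
    {E : ℝ → H → H} (hE : ∀ t v, E t v = ∑ i, (Real.exp (t * lam i) * ⟪b i, v⟫) • b i)
    {T : ℝ} (hT : 0 ≤ T) {F : H → H} (hF : ContDiff ℝ 1 F) {c : H → ℝ} (hc : Continuous c)
    (hF' : ∀ x y : H, ⟪fderiv ℝ F x y, y⟫ ≤ c x * ‖y‖ ^ 2 + ⟪y, -A y⟫)
    {o : ℝ → H} (ho : ContinuousOn o (Icc 0 T)) {X : ℝ → ℝ → H → H}
    (hXc : ∀ s ∈ Icc 0 T, ∀ x, ContinuousOn (fun t => X s t x) (Icc s T))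
    (hX : ∀ s ∈ Icc 0 T, ∀ x, ∀ t ∈ Icc s T,
      X s t x = E (t - s) x + (∫ u in s..t, E (t - u) (F (X s u x))) + o t - E (t - s) (o s)) :
    Continuous (fun q : {p : ℝ × ℝ | 0 ≤ p.1 ∧ p.1 ≤ p.2 ∧ p.2 ≤ T} × H =>
      X (q.1 : ℝ × ℝ).1 (q.1 : ℝ × ℝ).2 q.2) ∧
    (∀ s t, 0 ≤ s → s ≤ t → t ≤ T → ∀ x, DifferentiableAt ℝ (X s t) x) ∧
    Continuous (fun q : {p : ℝ × ℝ | 0 ≤ p.1 ∧ p.1 ≤ p.2 ∧ p.2 ≤ T} × H =>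
      fderiv ℝ (X (q.1 : ℝ × ℝ).1 (q.1 : ℝ × ℝ).2) q.2) ∧
    ∀ s t, 0 ≤ s → s ≤ t → t ≤ T → ∀ x,
      ‖fderiv ℝ (X s t) x‖ ≤ Real.exp (∫ u in s..t, c (X s u x)) := by
  obtain ⟨L, hL⟩ : ∃ L : H →L[ℝ] H, ∀ v, A v = L v :=
    ⟨∑ i, lam i • (innerSL ℝ (b i)).smulRight (b i), fun v => by
      simp [hA, smul_smul]⟩
  set O : ℝ → H := fun t => o (projIcc 0 T hT t)
  have hO : Continuous O := (continuousOn_iff_continuous_domRestrict.1 ho).comp continuous_projIcc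
  have hOo : ∀ t ∈ Icc 0 T, O t = o t := fun t ht => by simp [O, projIcc_of_mem _ ht]
  set Δ : Set (ℝ × ℝ) := {p : ℝ × ℝ | 0 ≤ p.1 ∧ p.1 ≤ p.2 ∧ p.2 ≤ T}
  let τ (l : Δ) (r : ℝ) : ℝ := l.1.1 + (l.1.2 - l.1.1) * r
  have hτ : Continuous fun q : Δ × ℝ => τ q.1 q.2 := by fun_prop
  have hτmem (l : Δ) (r : ℝ) (hr : r ∈ Icc (0 : ℝ) 1) : τ l r ∈ Icc l.1.1 T := by
    obtain ⟨h0, h1, h2⟩ := l.2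
    constructor
    · have := mul_nonneg (sub_nonneg.2 h1) hr.1
      simp only [τ]; linarith
    · have := mul_le_mul_of_nonneg_left hr.2 (sub_nonneg.2 h1)
      simp only [τ]; linarith
  have hs (l : Δ) : l.1.1 ∈ Icc 0 T := ⟨l.2.1, l.2.2.1.trans l.2.2.2⟩
  have hτ0 (l : Δ) (r : ℝ) (hr : r ∈ Icc (0 : ℝ) 1) : τ l r ∈ Icc 0 T :=
    Icc_subset_Icc_left (hs l).1 (hτmem l r hr)
  have hτone (l : Δ) : τ l 1 = l.1.2 := by simp [τ]
  have hτzero (l : Δ) : τ l 0 = l.1.1 := by simp [τ]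
  have hElin (t : ℝ) (v w : H) : E t (v - w) = E t v - E t w := by
    simp only [hE, inner_sub_right, mul_sub, sub_smul, Finset.sum_sub_distrib]
  have hZ (l : Δ) (x : H) {t : ℝ} (ht : t ∈ Icc l.1.1 T) :
      HasDerivWithinAt (fun t => X l.1.1 t x - o t) (L (X l.1.1 t x - o t) + F (X l.1.1 t x))
        (Icc l.1.1 T) t := by
    rw [← hL]
    refine hasDerivWithinAt_of_mild_equation b hA hE (hs l).2
      (hF.continuous.comp_continuousOn (hXc _ (hs l) x)) (x - o l.1.1) (fun t ht => ?_) ht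
    rw [hX _ (hs l) x t ht, hElin]
    simp only [Function.comp_apply]
    abel
  let G (l : Δ) (r : ℝ) (z : H) : H := (l.1.2 - l.1.1) • (L z + F (z + O (τ l r)))
  let G' (l : Δ) (r : ℝ) (z : H) : H →L[ℝ] H :=
    (l.1.2 - l.1.1) • (L + fderiv ℝ F (z + O (τ l r)))
  let y (l : Δ) (x : H) (r : ℝ) : H := X l.1.1 (τ l r) x - o (τ l r)
  have hOτ : Continuous fun q : Δ × ℝ × H => q.2.2 + O (τ q.1 q.2.1) :=
    (by fun_prop : Continuous fun q : Δ × ℝ × H => q.2.2).add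
      (hO.comp (hτ.comp (by fun_prop : Continuous fun q : Δ × ℝ × H => (q.1, q.2.1))))
  have hl : Continuous fun q : Δ × ℝ × H => q.1.1.2 - q.1.1.1 := by fun_prop
  have hX0 (s : ℝ) (hs : s ∈ Icc 0 T) (x : H) : X s s x = x := by
    have hE0 (v : H) : E 0 v = v := by simp [hE, b.sum_repr']
    rw [hX s hs x s ⟨le_rfl, hs.2⟩]
    simp [hE0]
  have hyX (l : Δ) (x : H) (r : ℝ) (hr : r ∈ Icc (0 : ℝ) 1) :
      y l x r + O (τ l r) = X l.1.1 (τ l r) x := by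
    simp only [y, hOo _ (hτ0 l r hr), sub_add_cancel]
  obtain ⟨hcont, D, hD0, hD, hDX, hDcont⟩ := contDiff_parametric_ODE_solution (G := G) (G' := G')
    (c := fun l : Δ => -O l.1.1) (y := y)
    (hl.smul ((L.continuous.comp (by fun_prop)).add (hF.continuous.comp hOτ)))
    (hl.smul (continuous_const.add ((hF.continuous_fderiv one_ne_zero).comp hOτ)))
    (fun l r z => by
      have h1 := ((hF.differentiable one_ne_zero) (z + O (τ l r))).hasFDerivAt.comp z
        ((hasFDerivAt_id z).add_const (O (τ l r)))
      rw [ContinuousLinearMap.comp_id] at h1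
      exact (L.hasFDerivAt.add h1).const_smul (l.1.2 - l.1.1))
    (by fun_prop) (fun l z => by
      simp only [y, hτzero, hX0 _ (hs l), hOo _ (hs l), sub_eq_add_neg])
    (fun l z r hr => by
      have h1 : HasDerivWithinAt (τ l) (l.1.2 - l.1.1) (Icc 0 1) r := by
        have h := ((hasDerivAt_id r).const_mul (l.1.2 - l.1.1)).const_add l.1.1
        rw [mul_one] at h
        exact h.hasDerivWithinAt
      have h2 := (hZ l z (hτmem l r hr)).scomp r h1 (hτmem l)
      simp only [G, hyX l z r hr]
      exact h2)
  have hy1 (l : Δ) (x : H) : X l.1.1 l.1.2 x = y l x 1 + O l.1.2 := by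
    rw [← hτone l, hyX l x 1 (by simp)]
  have hfd (l : Δ) (x : H) : HasFDerivAt (X l.1.1 l.1.2) (D l x 1) x := by
    have h := (hDX l x).add_const (O l.1.2)
    exact h.congr_of_eventuallyEq (Eventually.of_forall (hy1 l))
  refine ⟨?_, fun s t h0 hst htT x => (hfd ⟨(s, t), h0, hst, htT⟩ x).differentiableAt, ?_, ?_⟩
  · simp only [hy1]
    exact hcont.add (hO.comp (by fun_prop))
  · simp only [(hfd _ _).fderiv]
    exact hDcont
  intro s t h0 hst htT x
  set l : Δ := ⟨(s, t), h0, hst, htT⟩ with hldef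
  rw [(hfd l x).fderiv]
  refine ContinuousLinearMap.opNorm_le_bound _ (Real.exp_pos _).le fun v => ?_
  have hcy : ContinuousOn (fun r => c (X s (τ l r) x)) (Icc 0 1) :=
    hc.comp_continuousOn ((hXc s (hs l) x).comp
      (hτ.comp (by fun_prop : Continuous fun r : ℝ => (l, r))).continuousOn (hτmem l))
  set C : ℝ → ℝ := fun r => 2 * (t - s) * c (X s (τ l (projIcc (0 : ℝ) 1 zero_le_one r)) x)
    with hCdef
  have hC : Continuous C := continuous_const.mul
    ((continuousOn_iff_continuous_domRestrict.1 hcy).comp continuous_projIcc)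
  have hCr (r : ℝ) (hr : r ∈ Icc (0 : ℝ) 1) : C r = 2 * (t - s) * c (X s (τ l r) x) := by
    simp only [hCdef, projIcc_of_mem _ hr]
  have hint : ∫ r in (0 : ℝ)..1, C r = 2 * ∫ u in s..t, c (X s u x) := by
    have h1 : ∫ r in (0 : ℝ)..1, C r = ∫ r in (0 : ℝ)..1, 2 * (t - s) * c (X s (τ l r) x) := by
      refine intervalIntegral.integral_congr fun r hr => ?_
      rw [uIcc_of_le zero_le_one] at hr
      exact hCr r hr
    have h2 := intervalIntegral.smul_integral_comp_add_mul (a := 0) (b := 1)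
      (fun u => c (X s u x)) (t - s) s
    rw [h1, intervalIntegral.integral_const_mul, mul_assoc]
    simpa [τ, hldef] using h2
  have hDv (r : ℝ) (hr : r ∈ Icc (0 : ℝ) 1) :
      HasDerivWithinAt (fun r => D l x r v) (G' l r (y l x r) (D l x r v)) (Icc 0 1) r := by
    simpa using (hD l x r hr).clm_apply (hasDerivWithinAt_const r (Icc 0 1) v)
  have key := le_mul_exp_integral_of_deriv_le hC (fun r hr => (hDv r hr).norm_sq) fun r hr => by
    rw [hCr r hr]
    have h1 := hF' (X s (τ l r) x) (D l x r v)
    rw [inner_neg_right, real_inner_comm, hL] at h1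
    simp only [G', hyX l x r hr, smul_apply, add_apply,
      inner_smul_right, inner_add_right]
    have h2 := mul_le_mul_of_nonneg_left h1 (sub_nonneg.2 hst)
    simp only [hldef] at h2 ⊢
    linarith
  rw [hint, hD0, mul_comm 2, Real.exp_mul, ContinuousLinearMap.id_apply, Real.rpow_two,
    mul_comm, ← mul_pow] at key
  exact le_of_sq_le_sq key (by positivity)

end Mild

theorem measurable_continuousLinearMap_of_apply {H : Type*} [NormedAddCommGroup H]
    [InnerProductSpace ℝ H] [FiniteDimensional ℝ H] [MeasurableSpace H] [BorelSpace H]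
    [MeasurableSpace (H →L[ℝ] H)] [BorelSpace (H →L[ℝ] H)] {Ω : Type*} [MeasurableSpace Ω]
    {L : Ω → H →L[ℝ] H} (hL : ∀ v, Measurable fun ω => L ω v) : Measurable L := by
  have : ProperSpace H := FiniteDimensional.proper ℝ H
  set b := stdOrthonormalBasis ℝ H
  let Φ (f : Fin (Module.finrank ℝ H) → H) : H →L[ℝ] H :=
    ∑ i, ContinuousLinearMap.smulRightL ℝ H H (innerSL ℝ (b i)) (f i)
  have hΦ : Continuous Φ := by fun_prop
  have hLΦ : L = fun ω => Φ fun i => L ω (b i) := by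
    ext ω v
    conv_lhs => rw [← b.sum_repr' v]
    simp [Φ]
  rw [hLΦ]
  exact hΦ.measurable.comp (measurable_pi_lambda _ fun i => hL (b i))

/-- In the probabilistic setting with diagonal operator `A`
(`‖v‖_{H_{1/2}}² = ⟨v, −Av⟩`), semigroup `E`, `F ∈ C¹` with
`⟨F′(x)y, y⟩ ≤ (ε‖x‖_{H_{1/2}}² + C)‖y‖² + ‖y‖_{H_{1/2}}²`, jointly measurable
`Y : [0,T] × Ω → H`, noise `O` with continuous sample paths, and flows `X_{s,t}^x(ω)`
solving the mild equation, with `Δ_T = {(s,t) : 0 ≤ s ≤ t ≤ T}`: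
(i) pathwise `C^{0,0,1}` regularity on `Δ_T × H`; (ii) joint measurability of
`(s,t,ω) ↦ ∂_x X_{s,t}^{Y_s(ω)}(ω)`; (iii) joint measurability of
`(s,t,ω) ↦ X_{s,t}^{Y_s(ω)}(ω)`; and (iv) for all `(s,t) ∈ Δ_T`,
`E[‖∂_x X_{s,t}^{Y_s}‖_{L(H)}^p] ≤ E[exp(p ∫_s^t (ε‖X_{s,u}^{Y_s}‖_{H_{1/2}}² + C) du)]`. -/
theorem stmt_9
    {H : Type*} [NormedAddCommGroup H] [InnerProductSpace ℝ H]
    [FiniteDimensional ℝ H] [Nontrivial H] [MeasurableSpace H] [BorelSpace H]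
    [MeasurableSpace (H →L[ℝ] H)] [BorelSpace (H →L[ℝ] H)]
    {ι : Type*} [Fintype ι] (b : OrthonormalBasis ι ℝ H)
    (lam : ι → ℝ) (hlam : ∀ i, lam i < 0)
    (A : H → H) (hA : ∀ v, A v = ∑ i, (lam i * ⟪b i, v⟫) • b i)
    (E : ℝ → H → H)
    (hE : ∀ t v, E t v = ∑ i, (Real.exp (t * lam i) * ⟪b i, v⟫) • b i)
    {Ω : Type*} [MeasurableSpace Ω] (Pr : Measure Ω) [IsProbabilityMeasure Pr]
    (T : ℝ) (hT : 0 < T)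
    (ε C p : ℝ) (hε : 0 ≤ ε) (hC : 0 ≤ C) (hp : 1 ≤ p)
    (F : H → H) (hF : ContDiff ℝ 1 F)
    (hF' : ∀ x y : H,
      ⟪(fderiv ℝ F x) y, y⟫ ≤ (ε * ⟪x, -(A x)⟫ + C) * ‖y‖ ^ 2 + ⟪y, -(A y)⟫)
    (Y : ℝ → Ω → H)
    (hY : Measurable fun q : Set.Icc (0 : ℝ) T × Ω => Y (↑q.1) q.2)
    (O : ℝ → Ω → H)
    (hOmeas : ∀ t, Measurable fun ω => O t ω)
    (hOcont : ∀ ω, ContinuousOn (fun t => O t ω) (Set.Icc (0 : ℝ) T))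
    (X : ℝ → ℝ → H → Ω → H)
    (hXmeas : ∀ s t x, Measurable fun ω => X s t x ω)
    (hXcont : ∀ s ∈ Set.Icc (0 : ℝ) T, ∀ x : H, ∀ ω,
      ContinuousOn (fun t => X s t x ω) (Set.Icc s T))
    (hXeq : ∀ s ∈ Set.Icc (0 : ℝ) T, ∀ x : H, ∀ t ∈ Set.Icc s T, ∀ ω,
      X s t x ω = E (t - s) x + (∫ u in s..t, E (t - u) (F (X s u x ω))) + O t ω
        - E (t - s) (O s ω)) :
    (∀ ω,
      ContinuousOn (fun p : ℝ × ℝ × H => X p.1 p.2.1 p.2.2 ω)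
          {p : ℝ × ℝ × H | 0 ≤ p.1 ∧ p.1 ≤ p.2.1 ∧ p.2.1 ≤ T} ∧
      (∀ s t : ℝ, 0 ≤ s → s ≤ t → t ≤ T → ∀ x : H,
        DifferentiableAt ℝ (fun z => X s t z ω) x) ∧
      ContinuousOn (fun p : ℝ × ℝ × H => fderiv ℝ (fun z => X p.1 p.2.1 z ω) p.2.2)
          {p : ℝ × ℝ × H | 0 ≤ p.1 ∧ p.1 ≤ p.2.1 ∧ p.2.1 ≤ T}) ∧
    Measurable (fun q : {p : ℝ × ℝ | 0 ≤ p.1 ∧ p.1 ≤ p.2 ∧ p.2 ≤ T} × Ω =>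
      fderiv ℝ (fun z => X (q.1 : ℝ × ℝ).1 (q.1 : ℝ × ℝ).2 z q.2)
        (Y (q.1 : ℝ × ℝ).1 q.2)) ∧
    Measurable (fun q : {p : ℝ × ℝ | 0 ≤ p.1 ∧ p.1 ≤ p.2 ∧ p.2 ≤ T} × Ω =>
      X (q.1 : ℝ × ℝ).1 (q.1 : ℝ × ℝ).2 (Y (q.1 : ℝ × ℝ).1 q.2) q.2) ∧
    (∀ s t : ℝ, 0 ≤ s → s ≤ t → t ≤ T →
      (∫⁻ ω, ENNReal.ofReal
          (‖fderiv ℝ (fun z => X s t z ω) (Y s ω)‖ ^ p) ∂Pr) ≤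
        ∫⁻ ω, ENNReal.ofReal (Real.exp (p * ∫ u in s..t,
          (ε * ⟪X s u (Y s ω) ω, -(A (X s u (Y s ω) ω))⟫ + C))) ∂Pr) := by
  have hAc : Continuous A := by
    simp only [funext hA]
    fun_prop
  have hreg (ω : Ω) := mild_flow_regularity b hA hE hT.le hF
    (c := fun x => ε * ⟪x, -(A x)⟫ + C) (by fun_prop) hF' (hOcont ω)
    (X := fun s t x => X s t x ω) (fun s hs x => hXcont s hs x ω)
    (fun s hs x t ht => hXeq s hs x t ht ω)
  have : ProperSpace H := FiniteDimensional.proper ℝ H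
  set Δ : Set (ℝ × ℝ) := {p : ℝ × ℝ | 0 ≤ p.1 ∧ p.1 ≤ p.2 ∧ p.2 ≤ T}
  have hincl : Continuous fun q : {p : ℝ × ℝ × H | 0 ≤ p.1 ∧ p.1 ≤ p.2.1 ∧ p.2.1 ≤ T} =>
      ((⟨(q.1.1, q.1.2.1), q.2⟩ : Δ), q.1.2.2) := by fun_prop
  have hYs : Measurable fun q : Δ × Ω => ((q.1, Y q.1.1.1 q.2), q.2) := by
    have h1 : Measurable fun q : Δ × Ω =>
        ((⟨q.1.1.1, q.1.2.1, q.1.2.2.1.trans q.1.2.2.2⟩ : Icc (0 : ℝ) T), q.2) := by fun_prop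
    exact (measurable_fst.prodMk (hY.comp h1)).prodMk measurable_snd
  refine ⟨fun ω => ⟨?_, (hreg ω).2.1, ?_⟩, ?_, ?_, fun s t h0 hst htT => ?_⟩
  · exact continuousOn_iff_continuous_domRestrict.2 ((hreg ω).1.comp hincl)
  · exact continuousOn_iff_continuous_domRestrict.2 ((hreg ω).2.2.1.comp hincl)
  · refine (measurable_uncurry_of_continuous_of_measurable
      (u := fun (d : Δ × H) ω => fderiv ℝ (fun z => X d.1.1.1 d.1.1.2 z ω) d.2)
      (fun ω => (hreg ω).2.2.1) fun d => ?_).comp hYs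
    refine measurable_continuousLinearMap_of_apply fun v => ?_
    refine measurable_of_tendsto_metrizable (f := fun (n : ℕ) ω => (n : ℝ) •
        (X d.1.1.1 d.1.1.2 (d.2 + (n : ℝ)⁻¹ • v) ω - X d.1.1.1 d.1.1.2 d.2 ω))
      (fun n => ((hXmeas _ _ _).sub (hXmeas _ _ _)).const_smul _) (tendsto_pi_nhds.2 fun ω => ?_)
    refine ((hreg ω).2.1 _ _ d.1.2.1 d.1.2.2.1 d.1.2.2.2 d.2).hasFDerivAt.lim v ?_
    simpa using tendsto_natCast_atTop_atTop
  · exact (measurable_uncurry_of_continuous_of_measurable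
      (u := fun (d : Δ × H) ω => X d.1.1.1 d.1.1.2 d.2 ω)
      (fun ω => (hreg ω).1) fun d => hXmeas _ _ _).comp hYs
  · refine lintegral_mono fun ω => ENNReal.ofReal_le_ofReal ?_
    rw [mul_comm p, Real.exp_mul]
    exact Real.rpow_le_rpow (norm_nonneg _) ((hreg ω).2.2.2 s t h0 hst htT _) (by linarith)
end

section
/- It holds that ‖ 1_D(Y) · P F(Y) − F(Y) ‖_{L^p(ℙ;H)} ≤ c^{−α} h^{ας} ‖ r(Y) ‖_{L^{2pα}(ℙ;ℝ)}^{α} ‖ P F(Y) ‖_{L^{2p}(ℙ;H)} + ‖ (P − Id_H) F(Y) ‖_{L^p(ℙ;H)}, where 1_D denotes the indicator function of D and ‖V‖_{L^q(ℙ;E)} = (E[‖V‖_E^q])^{1/q} ∈ [0,∞]. -/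
open MeasureTheory Set
open scoped ENNReal RealInnerProductSpace NNReal

/-- If `x` exceeds `c h^{-ς}`, then `c^{-α} h^{ας} x^α` is at least one. -/
lemma one_le_rpow_scale_of_lt {ς α c h x : ℝ} (hα : 0 < α) (hc : 0 < c) (hh : 0 < h)
    (hx : c * h ^ (-ς) < x) : 1 ≤ c ^ (-α) * h ^ (α * ς) * x ^ α := by
  have hb : 0 < c * h ^ (-ς) := by positivity
  have hscale : c ^ (-α) * h ^ (α * ς) * (c * h ^ (-ς)) ^ α = 1 := by
    rw [Real.mul_rpow hc.le (by positivity), ← Real.rpow_mul hh.le,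
      mul_mul_mul_comm, ← Real.rpow_add hc, ← Real.rpow_add hh]
    ring_nf
    simp
  calc 1 = c ^ (-α) * h ^ (α * ς) * (c * h ^ (-ς)) ^ α := hscale.symm
    _ ≤ _ := by gcongr

/-- Hölder's inequality with a power weight: `‖(K f^α) • g‖_p ≤ K ‖f‖_{2pα}^α ‖g‖_{2p}`. -/
lemma eLpNorm_const_mul_rpow_smul_le {Ω E : Type*} [MeasurableSpace Ω] {μ : Measure Ω}
    [NormedAddCommGroup E] [NormedSpace ℝ E] {f : Ω → ℝ} {g : Ω → E} {p α K : ℝ}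
    (hp : 0 < p) (hα : 0 < α) (hK : 0 ≤ K) (hf : Measurable f) (hf0 : ∀ ω, 0 ≤ f ω)
    (hg : AEStronglyMeasurable g μ) :
    eLpNorm (fun ω => (K * f ω ^ α) • g ω) (ENNReal.ofReal p) μ ≤
      ENNReal.ofReal K * eLpNorm f (ENNReal.ofReal (2 * p * α)) μ ^ α *
        eLpNorm g (ENNReal.ofReal (2 * p)) μ := by
  have : ENNReal.HolderTriple (ENNReal.ofReal (2 * p)) (ENNReal.ofReal (2 * p))
      (ENNReal.ofReal p) := by
    constructor
    rw [← ENNReal.ofReal_inv_of_pos (by positivity), ← ENNReal.ofReal_inv_of_pos hp,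
      ← ENNReal.ofReal_add (by positivity) (by positivity)]
    congr 1
    field_simp
    norm_num
  have hrpow : eLpNorm (fun ω => f ω ^ α) (ENNReal.ofReal (2 * p)) μ =
      eLpNorm f (ENNReal.ofReal (2 * p * α)) μ ^ α := by
    rw [ENNReal.ofReal_mul (p := 2 * p) (by positivity), ← eLpNorm_norm_rpow f hα]
    simp only [Real.norm_of_nonneg (hf0 _)]
  calc eLpNorm (fun ω => (K * f ω ^ α) • g ω) (ENNReal.ofReal p) μ
      ≤ eLpNorm (fun ω => K * f ω ^ α) (ENNReal.ofReal (2 * p)) μ *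
          eLpNorm g (ENNReal.ofReal (2 * p)) μ :=
        eLpNorm_smul_le_mul_eLpNorm hg
          ((hf.pow_const α).const_mul K).aestronglyMeasurable
    _ = _ := by
        have hconst : eLpNorm (fun ω => K * f ω ^ α) (ENNReal.ofReal (2 * p)) μ =
            ENNReal.ofReal K * eLpNorm (fun ω => f ω ^ α) (ENNReal.ofReal (2 * p)) μ := by
          rw [← Real.enorm_of_nonneg hK]
          exact eLpNorm_const_smul K (fun ω => f ω ^ α) _ _
        rw [hconst, hrpow]

/-- Truncation error estimate: for a separable real Hilbert space `H`,
a probability space `(Ω, 𝔉, ℙ)`, a real Banach space `V`, `ς ∈ [0,∞)`, `p ∈ [1,∞)`,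
`α, c, h ∈ (0,∞)`, a measurable `Y : Ω → V`, Borel measurable `r : V → [0,∞)`, a bounded
linear `P : H → H`, Borel measurable `F : V → H`, and `D ∈ ℬ(V)` with
`{v : r(v) ≤ c h^{−ς}} ⊆ D`, one has (with `‖·‖_{L^q}` realized by `eLpNorm`):
`‖1_D(Y)·P F(Y) − F(Y)‖_{L^p} ≤ c^{−α} h^{ας} ‖r(Y)‖_{L^{2pα}}^α ‖P F(Y)‖_{L^{2p}}
+ ‖(P − Id) F(Y)‖_{L^p}`. -/
theorem stmt_10
    {H : Type*} [NormedAddCommGroup H] [InnerProductSpace ℝ H]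
    [CompleteSpace H] [Nontrivial H] [TopologicalSpace.SeparableSpace H]
    [MeasurableSpace H] [BorelSpace H]
    {Ω : Type*} [MeasurableSpace Ω] (Pr : Measure Ω) [IsProbabilityMeasure Pr]
    {V : Type*} [NormedAddCommGroup V] [NormedSpace ℝ V] [CompleteSpace V]
    [MeasurableSpace V] [BorelSpace V]
    (ς : ℝ) (hς : 0 ≤ ς) (p : ℝ) (hp : 1 ≤ p)
    (α c h : ℝ) (hα : 0 < α) (hc : 0 < c) (hh : 0 < h)
    (Y : Ω → V) (hY : Measurable Y)
    (r : V → ℝ) (hr : Measurable r) (hr0 : ∀ v, 0 ≤ r v)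
    (P : H →L[ℝ] H)
    (F : V → H) (hF : Measurable F)
    (D : Set V) (hD : MeasurableSet D)
    (hDr : {v : V | r v ≤ c * h ^ (-ς)} ⊆ D) :
    eLpNorm
        (fun ω => (Set.indicator D (fun _ => (1 : ℝ)) (Y ω)) • P (F (Y ω)) - F (Y ω))
        (ENNReal.ofReal p) Pr ≤
      ENNReal.ofReal (c ^ (-α) * h ^ (α * ς)) *
          (eLpNorm (fun ω => r (Y ω)) (ENNReal.ofReal (2 * p * α)) Pr) ^ α *
          eLpNorm (fun ω => P (F (Y ω))) (ENNReal.ofReal (2 * p)) Pr +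
        eLpNorm (fun ω => P (F (Y ω)) - F (Y ω)) (ENNReal.ofReal p) Pr := by
  have : SecondCountableTopology H := UniformSpace.secondCountable_of_separable H
  have hFY : Measurable fun ω => F (Y ω) := hF.comp hY
  have hPFY : Measurable fun ω => P (F (Y ω)) := P.continuous.measurable.comp hFY
  have hind : Measurable fun ω => Dᶜ.indicator (fun _ => (1 : ℝ)) (Y ω) :=
    (measurable_const.indicator hD.compl).comp hY
  have hp1 : 1 ≤ ENNReal.ofReal p := ENNReal.one_le_ofReal.2 hp
  have hsplit : (fun ω => D.indicator (fun _ => (1 : ℝ)) (Y ω) • P (F (Y ω)) - F (Y ω)) =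
      (fun ω => P (F (Y ω)) - F (Y ω)) -
        fun ω => Dᶜ.indicator (fun _ => (1 : ℝ)) (Y ω) • P (F (Y ω)) := by
    funext ω
    by_cases hω : Y ω ∈ D <;> simp [hω]
  rw [hsplit]
  refine (eLpNorm_sub_le (hPFY.sub hFY).aestronglyMeasurable
    (hind.smul hPFY).aestronglyMeasurable hp1).trans
      ((add_le_add le_rfl ?_).trans_eq (add_comm _ _))
  refine (eLpNorm_mono fun ω => ?_).trans
    (eLpNorm_const_mul_rpow_smul_le (by linarith) hα (by positivity) (hr.comp hY)
      (fun ω => hr0 (Y ω)) hPFY.aestronglyMeasurable)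
  by_cases hω : Y ω ∈ D
  · simp [hω]
  · have hlt : c * h ^ (-ς) < r (Y ω) := not_le.1 fun hle => hω (hDr hle)
    have hone := one_le_rpow_scale_of_lt hα hc hh hlt
    have hind_eq : Dᶜ.indicator (fun _ => (1 : ℝ)) (Y ω) = 1 := by simp [hω]
    change ‖Dᶜ.indicator (fun _ => (1 : ℝ)) (Y ω) • P (F (Y ω))‖ ≤
      ‖(c ^ (-α) * h ^ (α * ς) * r (Y ω) ^ α) • P (F (Y ω))‖
    rw [hind_eq, one_smul, norm_smul]
    exact le_mul_of_one_le_left (norm_nonneg _) (hone.trans (le_abs_self _))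
end
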